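/- Let N ≥ 3 be a natural number and let γ be a real number with 0 < γ < 2. Then there exists a constant C > 0 such that for every R ≥ 1 and every x ∈ ℝ^N, ∫_{B_R(0)} |x - y|^{-(N-2)} (1+|y|)^{-γ} dy ≤ C R^{2-γ}, where B_R(0) is the open Euclidean ball of radius R centered at the origin of ℝ^N. -/

import Mathlib

open MeasureTheory

/-- The power `r ^ (-s)` truncated to `r < R`. -/
noncomputable def truncatedPower (s R : ℝ) : ℝ → ℝ :=
  (Set.Iio R).indicator fun r => r ^ (-s)

lemma truncatedPower_nonneg (s R : ℝ) {r : ℝ} (hr : 0 ≤ r) : 0 ≤ truncatedPower s R r := by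
  unfold truncatedPower
  by_cases h : r ∈ Set.Iio R
  · rw [Set.indicator_of_mem h]
    positivity
  · rw [Set.indicator_of_notMem h]

lemma rpow_neg_le_truncatedPower_add {s R r : ℝ} (hs : 0 ≤ s) (hR : 0 < R) :
    r ^ (-s) ≤ truncatedPower s R r + R ^ (-s) := by
  unfold truncatedPower
  by_cases h : r ∈ Set.Iio R
  · rw [Set.indicator_of_mem h]
    have : 0 ≤ R ^ (-s) := by positivity
    linarith
  · rw [Set.indicator_of_notMem h, zero_add]
    exact Real.rpow_le_rpow_of_nonpos hR (not_lt.mp h) (by linarith)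

lemma pow_smul_truncatedPower_eqOn {N : ℕ} (hN : 1 ≤ N) (s R : ℝ) :
    Set.EqOn (fun r : ℝ => r ^ (N - 1) • truncatedPower s R r)
      ((Set.Iio R).indicator fun r => r ^ ((N : ℝ) - 1 - s)) (Set.Ioi 0) := by
  intro r hr
  have hr : 0 < r := hr
  unfold truncatedPower
  by_cases h : r ∈ Set.Iio R
  · simp only [Set.indicator_of_mem h, smul_eq_mul]
    rw [← Real.rpow_natCast, ← Real.rpow_add hr]
    push_cast [Nat.cast_sub hN]
    ring_nf
  · simp only [Set.indicator_of_notMem h, smul_zero]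

lemma integrable_truncatedPower_norm {N : ℕ} (hN : 1 ≤ N) {s R : ℝ} (hs : s < N) (hR : 0 < R) :
    Integrable fun y : EuclideanSpace ℝ (Fin N) => truncatedPower s R ‖y‖ := by
  have : Nonempty (Fin N) := ⟨⟨0, hN⟩⟩
  rw [integrable_fun_norm_addHaar, finrank_euclideanSpace_fin,
    integrableOn_congr_fun (pow_smul_truncatedPower_eqOn hN s R) measurableSet_Ioi,
    IntegrableOn, integrable_indicator_iff measurableSet_Iio, IntegrableOn,
    Measure.restrict_restrict measurableSet_Iio, Set.inter_comm, Set.Ioi_inter_Iio]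
  exact (intervalIntegral.integrableOn_Ioo_rpow_iff hR).2 (by linarith)

lemma integral_truncatedPower_norm {N : ℕ} (hN : 1 ≤ N) {s R : ℝ} (hs : s < N) (hR : 0 < R) :
    ∫ y : EuclideanSpace ℝ (Fin N), truncatedPower s R ‖y‖ =
      N * volume.real (Metric.ball (0 : EuclideanSpace ℝ (Fin N)) 1) *
        (R ^ ((N : ℝ) - s) / (N - s)) := by
  have : Nonempty (Fin N) := ⟨⟨0, hN⟩⟩
  rw [integral_fun_norm_addHaar, finrank_euclideanSpace_fin,
    setIntegral_congr_fun measurableSet_Ioi (pow_smul_truncatedPower_eqOn hN s R),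
    setIntegral_indicator measurableSet_Iio, Set.Ioi_inter_Iio, ← integral_Ioc_eq_integral_Ioo,
    ← intervalIntegral.integral_of_le hR.le, integral_rpow (Or.inl (by linarith))]
  rw [show (N : ℝ) - 1 - s + 1 = N - s by ring, Real.zero_rpow (by linarith), sub_zero,
    nsmul_eq_mul, smul_eq_mul]
  ring

lemma rpow_neg_mul_rpow_neg_le {a b p q : ℝ} (ha : 0 < a) (hb : 0 < b) (hp : 0 ≤ p) (hq : 0 ≤ q) :
    a ^ (-p) * b ^ (-q) ≤ a ^ (-(p + q)) + b ^ (-(p + q)) := by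
  rw [neg_add, Real.rpow_add ha, Real.rpow_add hb]
  rcases le_total a b with h | h
  · have := Real.rpow_le_rpow_of_nonpos ha h (neg_nonpos.2 hq)
    have : a ^ (-p) * b ^ (-q) ≤ a ^ (-p) * a ^ (-q) := by gcongr
    have : 0 ≤ b ^ (-p) * b ^ (-q) := by positivity
    linarith
  · have := Real.rpow_le_rpow_of_nonpos hb h (neg_nonpos.2 hp)
    have : a ^ (-p) * b ^ (-q) ≤ b ^ (-p) * b ^ (-q) := by gcongr
    have : 0 ≤ a ^ (-p) * a ^ (-q) := by positivity
    linarith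

/-- interior Riesz-potential estimate, regime `0 < γ < 2`:
`∫_{B_R(0)} |x-y|^{-(N-2)} (1+|y|)^{-γ} dy ≤ C R^{2-γ}` on `ℝ^N`. -/
theorem stmt14 (N : ℕ) (hN : 3 ≤ N) (γ : ℝ) (hγ0 : 0 < γ) (hγ2 : γ < 2) :
    ∃ C > 0, ∀ R : ℝ, 1 ≤ R → ∀ x : EuclideanSpace ℝ (Fin N),
      ∫ y in Metric.ball (0 : EuclideanSpace ℝ (Fin N)) R,
          ‖x - y‖ ^ (-((N : ℝ) - 2)) * (1 + ‖y‖) ^ (-γ) ≤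
        C * R ^ (2 - γ) := by
  have : Nonempty (Fin N) := ⟨⟨0, by omega⟩⟩
  have hN1 : 1 ≤ N := by omega
  have hN3 : (3 : ℝ) ≤ N := by exact_mod_cast hN
  set s : ℝ := (N : ℝ) - 2 + γ with hs
  have hs0 : 0 < s := by linarith
  have hsN : s < N := by linarith
  set v : ℝ := volume.real (Metric.ball (0 : EuclideanSpace ℝ (Fin N)) 1) with hv
  have hv0 : 0 ≤ v := measureReal_nonneg
  refine ⟨2 * (N * v / (2 - γ)) + 2 * v + 1, ?_, fun R hR x => ?_⟩
  · have : 0 < 2 - γ := by linarith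
    positivity
  have hR0 : 0 < R := by linarith
  set f := truncatedPower s R with hf
  have hint : Integrable fun y : EuclideanSpace ℝ (Fin N) => f ‖y‖ :=
    integrable_truncatedPower_norm hN1 hsN hR0
  have hint' : Integrable fun y : EuclideanSpace ℝ (Fin N) => f ‖x - y‖ := hint.comp_sub_left x
  have hval : ∫ y : EuclideanSpace ℝ (Fin N), f ‖y‖ = N * v * (R ^ ((N : ℝ) - s) / (N - s)) :=
    integral_truncatedPower_norm hN1 hsN hR0
  have hval' : ∫ y : EuclideanSpace ℝ (Fin N), f ‖x - y‖ = ∫ y : EuclideanSpace ℝ (Fin N), f ‖y‖ :=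
    integral_sub_left_eq_self (fun y : EuclideanSpace ℝ (Fin N) => f ‖y‖) volume x
  have hle : ∫ y in Metric.ball (0 : EuclideanSpace ℝ (Fin N)) R, f ‖y‖ ≤
      ∫ y : EuclideanSpace ℝ (Fin N), f ‖y‖ :=
    setIntegral_le_integral hint (.of_forall fun y => truncatedPower_nonneg s R (norm_nonneg y))
  have hle' : ∫ y in Metric.ball (0 : EuclideanSpace ℝ (Fin N)) R, f ‖x - y‖ ≤
      ∫ y : EuclideanSpace ℝ (Fin N), f ‖x - y‖ :=
    setIntegral_le_integral hint' (.of_forall fun y => truncatedPower_nonneg s R (norm_nonneg _))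
  have hconst : IntegrableOn (fun _ : EuclideanSpace ℝ (Fin N) => 2 * R ^ (-s))
      (Metric.ball (0 : EuclideanSpace ℝ (Fin N)) R) :=
    integrableOn_const measure_ball_lt_top.ne
  have hvol : volume.real (Metric.ball (0 : EuclideanSpace ℝ (Fin N)) R) = R ^ (N : ℝ) * v := by
    rw [Measure.real, Measure.addHaar_ball _ _ hR0.le, finrank_euclideanSpace_fin,
      ENNReal.toReal_mul, ENNReal.toReal_ofReal (by positivity), Real.rpow_natCast]
    rfl
  have hne : ∀ z : EuclideanSpace ℝ (Fin N),
      ∀ᵐ y ∂volume.restrict (Metric.ball (0 : EuclideanSpace ℝ (Fin N)) R), y ≠ z :=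
    fun z => ae_restrict_of_ae (Measure.ae_ne volume z)
  calc
    _ ≤ ∫ y in Metric.ball (0 : EuclideanSpace ℝ (Fin N)) R,
          (f ‖x - y‖ + f ‖y‖ + 2 * R ^ (-s)) := by
      refine integral_mono_of_nonneg (.of_forall fun y => by positivity)
        ((hint'.integrableOn.add hint.integrableOn).add hconst) ?_
      filter_upwards [hne 0, hne x] with y hy0 hyx
      have h1 : 0 < ‖y‖ := norm_pos_iff.2 hy0
      have h2 : 0 < ‖x - y‖ := norm_pos_iff.2 (sub_ne_zero.2 hyx.symm)
      have h3 : (1 + ‖y‖) ^ (-γ) ≤ ‖y‖ ^ (-γ) :=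
        Real.rpow_le_rpow_of_nonpos h1 (by linarith) (by linarith)
      have h4 := rpow_neg_mul_rpow_neg_le h2 h1 (by linarith : 0 ≤ (N : ℝ) - 2) hγ0.le
      have h5 := rpow_neg_le_truncatedPower_add (r := ‖y‖) hs0.le hR0
      have h6 := rpow_neg_le_truncatedPower_add (r := ‖x - y‖) hs0.le hR0
      have h7 : ‖x - y‖ ^ (-((N : ℝ) - 2)) * (1 + ‖y‖) ^ (-γ) ≤
          ‖x - y‖ ^ (-((N : ℝ) - 2)) * ‖y‖ ^ (-γ) := by gcongr
      simp only [← hs, ← hf] at h4 h5 h6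
      linarith
    _ = (∫ y in Metric.ball (0 : EuclideanSpace ℝ (Fin N)) R, f ‖x - y‖) +
          (∫ y in Metric.ball (0 : EuclideanSpace ℝ (Fin N)) R, f ‖y‖) +
          R ^ (N : ℝ) * v * (2 * R ^ (-s)) := by
      have hsum : IntegrableOn (fun y => f ‖x - y‖ + f ‖y‖)
          (Metric.ball (0 : EuclideanSpace ℝ (Fin N)) R) :=
        hint'.integrableOn.add hint.integrableOn
      rw [integral_add hsum hconst,
        integral_add hint'.integrableOn hint.integrableOn, setIntegral_const, hvol, smul_eq_mul]
    _ ≤ 2 * (N * v * (R ^ ((N : ℝ) - s) / (N - s))) + R ^ (N : ℝ) * v * (2 * R ^ (-s)) := by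
      linarith
    _ = (2 * (N * v / (2 - γ)) + 2 * v) * R ^ (2 - γ) := by
      have h1 : R ^ (N : ℝ) * R ^ (-s) = R ^ (2 - γ) := by
        rw [← Real.rpow_add hR0]
        congr 1
        linarith
      rw [show (N : ℝ) - s = 2 - γ by linarith, ← h1]
      ring
    _ ≤ _ := by
      exact mul_le_mul_of_nonneg_right (by linarith) (by positivity)
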